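/- The M-lag Markov switching model family with nonlinear Gaussian initial and transition families is identifiable up to permutations, provided: (m1) unique indexing holds for both the initial Gaussian family (distinct indices give distinct (mean, covariance)) and the transition Gaussian family (distinct indices give mean or covariance maps differing on a positive-measure set of conditioning values); and (m2) for each transition index b, the mean map m(·,b): R^{mM} → R^m and covariance map Σ(·,b): R^{mM} → R^{m×m} are real-analytic. -/

import Mathlib

open MeasureTheory Matrix

/-- The multivariate Gaussian density on `ι → ℝ` with mean `μ` and covariance `S`. -/
noncomputable def gaussianPDF {ι : Type*} [Fintype ι] [DecidableEq ι]
    (μ : ι → ℝ) (S : Matrix ι ι ℝ) (z : ι → ℝ) : ℝ :=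
  Real.exp (-(1 / 2) * ((z - μ) ⬝ᵥ S⁻¹.mulVec (z - μ))) /
    Real.sqrt ((2 * Real.pi) ^ Fintype.card ι * S.det)

/-- Gaussian initial density family `I^M_A` on `z_{1:M}`, flattened. -/
noncomputable def gInit {A : Type*} {m M : ℕ}
    (μ0 : A → Fin M × Fin m → ℝ) (S0 : A → Matrix (Fin M × Fin m) (Fin M × Fin m) ℝ)
    (a : A) (h : Fin M → Fin m → ℝ) : ℝ :=
  gaussianPDF (μ0 a) (S0 a) (fun q : Fin M × Fin m => h q.1 q.2)

/-- Nonlinear Gaussian transition family `G^M_B`. -/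
noncomputable def gTrans {B : Type*} {m M : ℕ}
    (mfun : B → (Fin M → Fin m → ℝ) → Fin m → ℝ)
    (cov : B → (Fin M → Fin m → ℝ) → Matrix (Fin m) (Fin m) ℝ)
    (b : B) (x : Fin m → ℝ) (h : Fin M → Fin m → ℝ) : ℝ :=
  gaussianPDF (mfun b h) (cov b h) x

/-- The density of a single mixture trajectory of an `M`-lag Markov switching
model of length `T = M + L`. -/
noncomputable def trajDensity {A B : Type*} {m : ℕ} (M : ℕ)
    (pInit : A → (Fin M → Fin m → ℝ) → ℝ)
    (pTrans : B → (Fin m → ℝ) → (Fin M → Fin m → ℝ) → ℝ)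
    (L : ℕ) (a : A) (b : Fin L → B) (z : ℕ → Fin m → ℝ) : ℝ :=
  pInit a (fun i : Fin M => z (i : ℕ)) *
    ∏ s : Fin L,
      pTrans (b s) (z (M + (s : ℕ))) (fun τ : Fin M => z (M + (s : ℕ) - 1 - (τ : ℕ)))


open Filter Topology in
lemma aux_oneD {κ : Type*} (s : Finset κ) (α β c : κ → ℝ)
    (hinj : ∀ i ∈ s, ∀ j ∈ s, i ≠ j → α i ≠ α j ∨ β i ≠ β j)
    (h : ∀ t : ℝ, ∑ i ∈ s, c i * Real.exp (α i * t ^ 2 + β i * t) = 0) :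
    ∀ i ∈ s, c i = 0 := by
  classical
  by_contra hcon
  push Not at hcon
  obtain ⟨k, hk, hck⟩ := hcon
  obtain ⟨i0, hi0, hmax⟩ := Finset.exists_max_image (s.filter (fun i => c i ≠ 0))
    (fun i => toLex (α i, β i)) ⟨k, by simp [hk, hck]⟩
  rw [Finset.mem_filter] at hi0
  have hT : Tendsto (fun t : ℝ => ∑ i ∈ s,
      c i * Real.exp (t * ((α i - α i0) * t + (β i - β i0)))) atTop
      (𝓝 (∑ i ∈ s, if i = i0 then c i0 else 0)) := by
    refine tendsto_finsetSum _ (fun i hi => ?_)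
    by_cases hii : i = i0
    · subst hii; simp
    · by_cases hci : c i = 0
      · simp [hci, hii]
      · rw [if_neg hii]
        have hm := hmax i (by simp [hi, hci])
        rw [Prod.Lex.toLex_le_toLex] at hm
        have hne := hinj i hi i0 hi0.1 hii
        have hbot : Tendsto (fun t : ℝ => t * ((α i - α i0) * t + (β i - β i0))) atTop atBot := by
          rcases hm with hlt | ⟨he, hle⟩
          · refine Tendsto.atTop_mul_atBot₀ tendsto_id ?_
            refine tendsto_atBot_add_const_right _ _ ?_
            exact Tendsto.const_mul_atTop_of_neg (by simpa using hlt) tendsto_id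
          · simp only at he hle
            have : β i < β i0 := lt_of_le_of_ne hle (by tauto)
            have : ∀ t : ℝ, t * ((α i - α i0) * t + (β i - β i0)) = (β i - β i0) * t := by
              intro t; rw [he]; ring
            simp only [this]
            exact Tendsto.const_mul_atTop_of_neg (by linarith) tendsto_id
        simpa using (Real.tendsto_exp_atBot.comp hbot).const_mul (c i)
  have hz : ∀ t : ℝ, ∑ i ∈ s,
      c i * Real.exp (t * ((α i - α i0) * t + (β i - β i0))) = 0 := by
    intro t
    have : ∀ i ∈ s, c i * Real.exp (t * ((α i - α i0) * t + (β i - β i0))) =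
        (c i * Real.exp (α i * t ^ 2 + β i * t)) * Real.exp (-(α i0 * t ^ 2 + β i0 * t)) := by
      intro i _
      rw [mul_assoc, ← Real.exp_add]
      congr 2; ring
    rw [Finset.sum_congr rfl this, ← Finset.sum_mul, h t, zero_mul]
  simp only [hz] at hT
  have := tendsto_nhds_unique hT tendsto_const_nhds
  simp [hi0.1] at this
  exact hi0.2 this

lemma aux_dense_ne {E : Type*} [NormedAddCommGroup E] [NormedSpace ℝ E] (f : E → ℝ)
    (hf : ∀ x, AnalyticAt ℝ f x) (x0 : E) (hx0 : f x0 ≠ 0) :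
    IsOpen {x | f x ≠ 0} ∧ Dense {x | f x ≠ 0} := by
  have hcont : Continuous f := continuous_iff_continuousAt.2 (fun x => (hf x).continuousAt)
  refine ⟨isOpen_ne_fun hcont continuous_const, ?_⟩
  intro x
  by_contra hx
  apply hx0
  have hev : f =ᶠ[nhds x] 0 := by
    have := (isClosed_closure (s := {x | f x ≠ 0})).isOpen_compl.mem_nhds hx
    filter_upwards [this] with y hy
    by_contra hfy
    exact hy (subset_closure hfy)
  have := AnalyticOnNhd.eq_of_eventuallyEq (f := f) (g := 0) (fun y _ => hf y)
    (fun y _ => analyticAt_const) hev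
  rw [this]; rfl

lemma aux_finite_dense {E κ : Type*} [TopologicalSpace E] (s : Finset κ) (U : κ → Set E)
    (hU : ∀ i ∈ s, IsOpen (U i) ∧ Dense (U i)) : Dense {x | ∀ i ∈ s, x ∈ U i} := by
  classical
  suffices IsOpen {x | ∀ i ∈ s, x ∈ U i} ∧ Dense {x | ∀ i ∈ s, x ∈ U i} from this.2
  induction s using Finset.induction_on with
  | empty => simp
  | insert a s ha ih =>
    have h1 := ih (fun i hi => hU i (by simp [hi]))
    have h2 := hU a (by simp)
    have : {x | ∀ i ∈ insert a s, x ∈ U i} = U a ∩ {x | ∀ i ∈ s, x ∈ U i} := by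
      ext x; simp
    rw [this]
    exact ⟨h2.1.inter h1.1, h2.2.inter_of_isOpen_left h1.2 h2.1⟩

lemma aux_quad {ι : Type*} [Fintype ι] [DecidableEq ι] (D : Matrix ι ι ℝ) (hD : D.IsHermitian)
    (h : ∀ w, w ⬝ᵥ D.mulVec w = 0) : D = 0 := by
  ext i j
  have h1 := h (Pi.single i 1 + Pi.single j 1)
  have h2 := h (Pi.single i 1)
  have h3 := h (Pi.single j 1)
  have h4 := hD.apply i j
  simp [Matrix.mulVec_add, add_dotProduct, dotProduct_add] at h1 h2 h3 h4 ⊢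
  linarith

lemma aux_gauss {ι κ : Type*} [Fintype ι] [DecidableEq ι] (s : Finset κ)
    (μ : κ → ι → ℝ) (S : κ → Matrix ι ι ℝ) (c : κ → ℝ) (hS : ∀ k, (S k).PosDef)
    (hne : ∀ i ∈ s, ∀ j ∈ s, i ≠ j → μ i ≠ μ j ∨ S i ≠ S j)
    (h : ∀ x, ∑ k ∈ s, c k * gaussianPDF (μ k) (S k) x = 0) : ∀ k ∈ s, c k = 0 := by
  classical
  set P : κ → Matrix ι ι ℝ := fun k => (S k)⁻¹ with hP
  have hPpd : ∀ k, (P k).PosDef := fun k => (hS k).inv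
  have hsym : ∀ k (u v : ι → ℝ), u ⬝ᵥ (P k).mulVec v = v ⬝ᵥ (P k).mulVec u := by
    intro k u v
    have : (P k)ᵀ = P k := by simpa using (hPpd k).isHermitian.eq
    rw [dotProduct_mulVec, ← mulVec_transpose, this, dotProduct_comm]
  have hd : ∀ p ∈ s.offDiag, ∃ f : (ι → ℝ) → ℝ, (∀ x, AnalyticAt ℝ f x) ∧ (∃ x, f x ≠ 0) ∧
      ∀ w, f w ≠ 0 → (w ⬝ᵥ (P p.1).mulVec w ≠ w ⬝ᵥ (P p.2).mulVec w ∨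
        w ⬝ᵥ (P p.1).mulVec (μ p.1) ≠ w ⬝ᵥ (P p.2).mulVec (μ p.2)) := by
    rintro ⟨i, j⟩ hp
    rw [Finset.mem_offDiag] at hp
    obtain ⟨hi, hj, hij⟩ := hp
    simp only at hi hj hij ⊢
    by_cases hPe : P i = P j
    · have hSe : S i = S j := by
        have := congrArg (fun X : Matrix ι ι ℝ => X⁻¹) hPe
        simpa [hP, Matrix.nonsing_inv_nonsing_inv _ ((Matrix.isUnit_iff_isUnit_det _).1 (hS _).isUnit)] using this
      have hμ : μ i ≠ μ j := by have := hne i hi j hj hij; tauto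
      have hu : (P i).mulVec (μ i) - (P i).mulVec (μ j) ≠ 0 := by
        intro h0
        apply hμ
        exact Matrix.mulVec_injective_of_isUnit (hPpd i).isUnit (sub_eq_zero.1 h0)
      refine ⟨fun w => w ⬝ᵥ ((P i).mulVec (μ i) - (P i).mulVec (μ j)), ?_, ⟨_, fun h0 => hu (dotProduct_self_eq_zero.1 h0)⟩, ?_⟩
      · intro x
        exact Finset.analyticAt_fun_sum _ (fun k _ =>
          ((ContinuousLinearMap.proj (R := ℝ) (φ := fun _ : ι => ℝ) k).analyticAt x).mul
            analyticAt_const)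
      · intro w hw
        right
        rw [← hPe]
        beta_reduce at hw
        rwa [dotProduct_sub, sub_ne_zero] at hw
    · refine ⟨fun w => w ⬝ᵥ (P i - P j).mulVec w, ?_, ?_, ?_⟩
      · intro x
        exact Finset.analyticAt_fun_sum _ (fun k _ =>
          ((ContinuousLinearMap.proj (R := ℝ) (φ := fun _ : ι => ℝ) k).analyticAt x).mul
            (Finset.analyticAt_fun_sum _ (fun l _ => analyticAt_const.mul
              ((ContinuousLinearMap.proj (R := ℝ) (φ := fun _ : ι => ℝ) l).analyticAt x))))
      · by_contra hcon
        push Not at hcon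
        exact hPe (sub_eq_zero.1 (aux_quad _ ((hPpd i).isHermitian.sub (hPpd j).isHermitian) hcon))
      · intro w hw
        left
        beta_reduce at hw
        rwa [sub_mulVec, dotProduct_sub, sub_ne_zero] at hw
  choose! f hf1 hf2 hf3 using hd
  have hdense := aux_finite_dense s.offDiag (fun p => {w | f p w ≠ 0}) (fun p hp => by
    obtain ⟨x, hx⟩ := hf2 p hp
    exact aux_dense_ne _ (hf1 p hp) x hx)
  obtain ⟨w, hw⟩ := hdense.nonempty
  have key := aux_oneD s (fun k => -(1/2) * (w ⬝ᵥ (P k).mulVec w))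
    (fun k => w ⬝ᵥ (P k).mulVec (μ k))
    (fun k => c k * (Real.exp (-(1/2) * (μ k ⬝ᵥ (P k).mulVec (μ k))) /
      Real.sqrt ((2 * Real.pi) ^ Fintype.card ι * (S k).det))) ?_ ?_
  · intro k hk
    have hk0 := key k hk
    have hpos : 0 < Real.sqrt ((2 * Real.pi) ^ Fintype.card ι * (S k).det) := by
      have := (hS k).det_pos
      have := Real.pi_pos
      positivity
    rcases mul_eq_zero.1 hk0 with h0 | h0
    · exact h0
    · exact absurd h0 (by positivity)
  · intro i hi j hj hij
    have hm : (i, j) ∈ s.offDiag := by simp [hi, hj, hij]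
    rcases hf3 _ hm w (hw _ hm) with h1 | h1
    · left; intro h2; apply h1; simp only at h2 ⊢; linarith
    · right; exact h1
  · intro t
    rw [← h (t • w)]
    refine Finset.sum_congr rfl (fun k _ => ?_)
    unfold gaussianPDF
    rw [mul_assoc, div_mul_eq_mul_div, ← Real.exp_add]
    congr 3
    simp only [mulVec_sub, sub_dotProduct, dotProduct_sub, mulVec_smul, dotProduct_smul, smul_dotProduct, smul_eq_mul]
    have := hsym k w (μ k)
    simp only [hP] at this ⊢
    rw [← this]
    ring

lemma aux_cont {B : Type*} {m M : ℕ}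
    (mfun : B → (Fin M → Fin m → ℝ) → Fin m → ℝ)
    (cov : B → (Fin M → Fin m → ℝ) → Matrix (Fin m) (Fin m) ℝ)
    (hcovpd : ∀ b h, (cov b h).PosDef)
    (hmean_an : ∀ b i x, AnalyticAt ℝ (fun h => mfun b h i) x)
    (hcov_an : ∀ b i j x, AnalyticAt ℝ (fun h => cov b h i j) x) (b : B)
    {X : Type*} [TopologicalSpace X] (u : X → Fin m → ℝ) (v : X → Fin M → Fin m → ℝ)
    (hu : Continuous u) (hv : Continuous v) :
    Continuous (fun x => gTrans mfun cov b (u x) (v x)) := by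
  have h1 : Continuous (mfun b) := continuous_pi fun i =>
    continuous_iff_continuousAt.2 fun x => (hmean_an b i x).continuousAt
  have h2 : Continuous (cov b) := continuous_matrix fun i j =>
    continuous_iff_continuousAt.2 fun x => (hcov_an b i j x).continuousAt
  have h3 : Continuous (fun h => (cov b h)⁻¹) := by
    simp only [Matrix.inv_def, Ring.inverse_eq_inv']
    exact (h2.matrix_det.inv₀ (fun h => (hcovpd b h).det_pos.ne')).smul h2.matrix_adjugate
  have hs : Continuous (fun x => u x - mfun b (v x)) := hu.sub (h1.comp hv)
  unfold gTrans gaussianPDF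
  refine Continuous.div ?_ ?_ ?_
  · refine Real.continuous_exp.comp (continuous_const.mul ?_)
    exact hs.dotProduct ((h3.comp hv).matrix_mulVec hs)
  · exact Real.continuous_sqrt.comp (continuous_const.mul (h2.comp hv).matrix_det)
  · intro x
    have := (hcovpd b (v x)).det_pos
    have := Real.pi_pos
    positivity

lemma aux_cont_init {A : Type*} {m M : ℕ}
    (μ0 : A → Fin M × Fin m → ℝ) (S0 : A → Matrix (Fin M × Fin m) (Fin M × Fin m) ℝ) (a : A) :
    Continuous (gInit μ0 S0 a) := by
  have hs : Continuous (fun h : Fin M → Fin m → ℝ => (fun q : Fin M × Fin m => h q.1 q.2) - μ0 a) := by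
    fun_prop
  unfold gInit gaussianPDF
  refine Continuous.div_const ?_ _
  refine Real.continuous_exp.comp (continuous_const.mul ?_)
  exact hs.dotProduct (continuous_const.matrix_mulVec hs)

lemma aux_main {A B : Type*} {m M : ℕ} (hM : 0 < M)
    (μ0 : A → Fin M × Fin m → ℝ) (S0 : A → Matrix (Fin M × Fin m) (Fin M × Fin m) ℝ)
    (mfun : B → (Fin M → Fin m → ℝ) → Fin m → ℝ)
    (cov : B → (Fin M → Fin m → ℝ) → Matrix (Fin m) (Fin m) ℝ)
    (hS0pd : ∀ a, (S0 a).PosDef)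
    (hcovpd : ∀ b h, (cov b h).PosDef)
    (huniq_init : ∀ a a', a ≠ a' → μ0 a ≠ μ0 a' ∨ S0 a ≠ S0 a')
    (huniq_trans : ∀ b b', b ≠ b' → ∃ Z : Set (Fin M → Fin m → ℝ), 0 < volume Z ∧
      ∀ h ∈ Z, mfun b h ≠ mfun b' h ∨ cov b h ≠ cov b' h)
    (hmean_an : ∀ b i x, AnalyticAt ℝ (fun h => mfun b h i) x)
    (hcov_an : ∀ b i j x, AnalyticAt ℝ (fun h => cov b h i j) x)
    {κ : Type*} (L : ℕ) : ∀ (s : Finset κ) (a : κ → A) (b : κ → Fin L → B) (g : κ → ℝ)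
    (_ : ∀ i ∈ s, ∀ j ∈ s, a i = a j → b i = b j → i = j)
    (_ : ∀ z : ℕ → Fin m → ℝ,
      ∑ i ∈ s, g i * trajDensity M (gInit μ0 S0) (gTrans mfun cov) L (a i) (b i) z = 0),
    ∀ i ∈ s, g i = 0 := by
  classical
  induction L with
  | zero =>
    intro s a b g hinj h
    refine aux_gauss s (fun k => μ0 (a k)) (fun k => S0 (a k)) g (fun k => hS0pd _) ?_ ?_
    · intro i hi j hj hij
      exact huniq_init _ _ (fun he => hij (hinj i hi j hj he (Subsingleton.elim _ _)))
    · intro x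
      rw [← h (fun n q => if hn : n < M then x (⟨n, hn⟩, q) else 0)]
      refine Finset.sum_congr rfl (fun k _ => ?_)
      simp [trajDensity, gInit]
  | succ L ih =>
    intro s a b g hinj h
    have hsplit : ∀ k z, trajDensity M (gInit μ0 S0) (gTrans mfun cov) (L+1) (a k) (b k) z =
        trajDensity M (gInit μ0 S0) (gTrans mfun cov) L (a k) (fun i => b k i.castSucc) z *
          gTrans mfun cov (b k (Fin.last L)) (z (M + L)) (fun τ : Fin M => z (M + L - 1 - (τ : ℕ))) := by
      intro k z
      simp only [trajDensity, Fin.prod_univ_castSucc, Fin.val_castSucc, Fin.val_last, mul_assoc]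
    have hcontT : ∀ k, Continuous (fun z : ℕ → Fin m → ℝ =>
        trajDensity M (gInit μ0 S0) (gTrans mfun cov) L (a k) (fun i => b k i.castSucc) z) := by
      intro k
      unfold trajDensity
      refine ((aux_cont_init μ0 S0 (a k)).comp (by fun_prop)).mul ?_
      refine continuous_finsetProd _ (fun i _ => ?_)
      exact aux_cont mfun cov hcovpd hmean_an hcov_an _ _ _ (by fun_prop) (by fun_prop)
    have hupd : ∀ k z x, trajDensity M (gInit μ0 S0) (gTrans mfun cov) L (a k) (fun i => b k i.castSucc)
        (Function.update z (M + L) x) =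
        trajDensity M (gInit μ0 S0) (gTrans mfun cov) L (a k) (fun i => b k i.castSucc) z := by
      intro k z x
      have hlt : ∀ n, n < M + L → Function.update z (M + L) x n = z n := fun n hn =>
        Function.update_of_ne hn.ne _ _
      unfold trajDensity
      congr 1
      · congr 1; funext i; exact hlt _ (by omega)
      · refine Finset.prod_congr rfl (fun i _ => ?_)
        rw [hlt _ (by omega)]
        congr 1; funext τ; exact hlt _ (by omega)
    -- the finite set of last indices
    set B1 : Finset B := s.image (fun k => b k (Fin.last L)) with hB1
    have hd : ∀ p ∈ B1.offDiag, ∃ f : (Fin M → Fin m → ℝ) → ℝ, (∀ x, AnalyticAt ℝ f x) ∧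
        (∃ x, f x ≠ 0) ∧ ∀ w, f w ≠ 0 → (mfun p.1 w ≠ mfun p.2 w ∨ cov p.1 w ≠ cov p.2 w) := by
      rintro ⟨b1, b2⟩ hp
      rw [Finset.mem_offDiag] at hp
      obtain ⟨Z, hZ, hZ'⟩ := huniq_trans b1 b2 hp.2.2
      obtain ⟨h0, hh0⟩ := nonempty_of_measure_ne_zero hZ.ne'
      rcases hZ' h0 hh0 with h1 | h1
      · obtain ⟨i, hi⟩ := Function.ne_iff.1 h1
        refine ⟨fun h => mfun b1 h i - mfun b2 h i,
          fun x => (hmean_an b1 i x).sub (hmean_an b2 i x), ⟨h0, sub_ne_zero.2 hi⟩, ?_⟩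
        intro w hw
        left; intro he; apply hw; simp only at he; simp [he]
      · have : ∃ i j, cov b1 h0 i j ≠ cov b2 h0 i j := by
          by_contra hcon
          push Not at hcon
          exact h1 (Matrix.ext hcon)
        obtain ⟨i, j, hij⟩ := this
        refine ⟨fun h => cov b1 h i j - cov b2 h i j,
          fun x => (hcov_an b1 i j x).sub (hcov_an b2 i j x), ⟨h0, sub_ne_zero.2 hij⟩, ?_⟩
        intro w hw
        right; intro he; apply hw; simp only at he; simp [he]
    choose! f hf1 hf2 hf3 using hd
    have hdense := aux_finite_dense B1.offDiag (fun p => {w | f p w ≠ 0}) (fun p hp => by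
      obtain ⟨x, hx⟩ := hf2 p hp
      exact aux_dense_ne _ (hf1 p hp) x hx)
    -- generic histories
    have hgen : ∀ z : ℕ → Fin m → ℝ,
        (fun τ : Fin M => z (M + L - 1 - (τ : ℕ))) ∈ {x | ∀ i ∈ B1.offDiag, x ∈ {w | f i w ≠ 0}} →
        ∀ β ∈ B1, ∑ k ∈ s.filter (fun k => b k (Fin.last L) = β), g k *
          trajDensity M (gInit μ0 S0) (gTrans mfun cov) L (a k) (fun i => b k i.castSucc) z = 0 := by
      intro z hz
      set w : Fin M → Fin m → ℝ := fun τ : Fin M => z (M + L - 1 - (τ : ℕ)) with hw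
      refine aux_gauss B1 (fun β => mfun β w) (fun β => cov β w) _ (fun β => hcovpd _ _) ?_ ?_
      · intro i hi j hj hij
        have hm : (i, j) ∈ B1.offDiag := by simp only [Finset.mem_offDiag]; exact ⟨hi, hj, hij⟩
        exact hf3 _ hm w (hz _ hm)
      · intro x
        rw [← h (Function.update z (M + L) x)]
        rw [← Finset.sum_fiberwise_of_maps_to (s := s) (t := B1) (g := fun k => b k (Fin.last L))
          (fun k hk => Finset.mem_image_of_mem _ hk)]
        refine Finset.sum_congr rfl (fun β _ => ?_)
        rw [Finset.sum_mul]
        refine Finset.sum_congr rfl (fun k hk => ?_)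
        rw [hsplit, hupd, mul_assoc, (Finset.mem_filter.1 hk).2]
        have hhist : (fun τ : Fin M => Function.update z (M + L) x (M + L - 1 - (τ : ℕ))) = w := by
          funext τ
          rw [Function.update_of_ne (by omega)]
        rw [hhist, Function.update_self]
        rfl
    intro i hi
    refine ih (s.filter (fun k => b k (Fin.last L) = b i (Fin.last L))) a
      (fun k i => b k i.castSucc) g ?_ ?_ i (by simp [hi])
    · intro k hk l hl hakl hbkl
      rw [Finset.mem_filter] at hk hl
      refine hinj k hk.1 l hl.1 hakl ?_
      funext q
      refine Fin.lastCases ?_ (fun q => ?_) q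
      · rw [hk.2, hl.2]
      · exact congrFun hbkl q
    · intro z
      -- overwrite the history of z
      let ov : (Fin M → Fin m → ℝ) → ℕ → Fin m → ℝ := fun w n =>
        if hn : M + L - 1 - n < M ∧ n < M + L then w ⟨M + L - 1 - n, hn.1⟩ else z n
      have hov : ∀ w, (fun τ : Fin M => ov w (M + L - 1 - (τ : ℕ))) = w := by
        intro w; funext τ
        have h1 : M + L - 1 - (M + L - 1 - (τ : ℕ)) = τ := by omega
        simp only [ov, h1]
        rw [dif_pos ⟨τ.2, by omega⟩]
      have hovz : ov (fun τ : Fin M => z (M + L - 1 - (τ : ℕ))) = z := by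
        funext n
        simp only [ov]
        split_ifs with hn
        · congr 1; omega
        · rfl
      have hovc : Continuous ov := by
        refine continuous_pi (fun n => ?_)
        by_cases hn : M + L - 1 - n < M ∧ n < M + L
        · simp only [ov, hn, and_self, dite_true]; fun_prop
        · simp only [ov, hn, dite_false]; fun_prop
      have hFc : Continuous (fun w => ∑ k ∈ s.filter (fun k => b k (Fin.last L) = b i (Fin.last L)),
          g k * trajDensity M (gInit μ0 S0) (gTrans mfun cov) L (a k)
            (fun i => b k i.castSucc) (ov w)) :=
        continuous_finsetSum _ (fun k _ => continuous_const.mul ((hcontT k).comp hovc))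
      have hF0 := Continuous.ext_on hdense hFc (continuous_const (y := (0:ℝ))) (fun w hw =>
        hgen (ov w) (by rw [hov]; exact hw) (b i (Fin.last L)) (Finset.mem_image_of_mem _ hi))
      have := congrFun hF0 (fun τ : Fin M => z (M + L - 1 - (τ : ℕ)))
      simp only [hovz] at this
      exact this

/-- **Theorem 4.1**: the `M`-lag Markov switching model family with
nonlinear Gaussian initial and transition families is identifiable up to
permutations, under (m1) unique indexing of both families and (m2) real-analytic
transition mean and covariance maps. -/
theorem stmt9 {A B : Type*} {m M L K0 K K0' K' : ℕ} (hM : 0 < M) (hL : 0 < L)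
    (μ0 : A → Fin M × Fin m → ℝ) (S0 : A → Matrix (Fin M × Fin m) (Fin M × Fin m) ℝ)
    (mfun : B → (Fin M → Fin m → ℝ) → Fin m → ℝ)
    (cov : B → (Fin M → Fin m → ℝ) → Matrix (Fin m) (Fin m) ℝ)
    (hS0pd : ∀ a, (S0 a).PosDef)
    (hcovpd : ∀ b h, (cov b h).PosDef)
    -- (m1) unique indexing
    (huniq_init : ∀ a a', a ≠ a' → μ0 a ≠ μ0 a' ∨ S0 a ≠ S0 a')
    (huniq_trans : ∀ b b', b ≠ b' → ∃ Z : Set (Fin M → Fin m → ℝ), 0 < volume Z ∧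
      ∀ h ∈ Z, mfun b h ≠ mfun b' h ∨ cov b h ≠ cov b' h)
    -- (m2) analyticity
    (hmean_an : ∀ b i x, AnalyticAt ℝ (fun h => mfun b h i) x)
    (hcov_an : ∀ b i j x, AnalyticAt ℝ (fun h => cov b h i j) x)
    -- first MSM
    (c : Fin (K0 * K ^ L) → ℝ) (aIdx : Fin (K0 * K ^ L) → A)
    (bIdx : Fin (K0 * K ^ L) → Fin L → B)
    (hc : ∀ i, 0 < c i) (hcsum : ∑ i, c i = 1)
    (hA0 : ∃ A0 : Finset A, A0.card = K0 ∧ ∀ i, aIdx i ∈ A0)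
    (hB0 : ∃ B0 : Finset B, B0.card = K ∧ ∀ i s, bIdx i s ∈ B0)
    (hdistinct : Function.Injective fun i => (aIdx i, bIdx i))
    -- second MSM
    (c' : Fin (K0' * K' ^ L) → ℝ) (aIdx' : Fin (K0' * K' ^ L) → A)
    (bIdx' : Fin (K0' * K' ^ L) → Fin L → B)
    (hc' : ∀ j, 0 < c' j) (hcsum' : ∑ j, c' j = 1)
    (hA0' : ∃ A0 : Finset A, A0.card = K0' ∧ ∀ j, aIdx' j ∈ A0)
    (hB0' : ∃ B0 : Finset B, B0.card = K' ∧ ∀ j s, bIdx' j s ∈ B0)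
    (hdistinct' : Function.Injective fun j => (aIdx' j, bIdx' j))
    -- equality of the two mixture distributions
    (heq : ∀ z : ℕ → Fin m → ℝ,
      ∑ i, c i * trajDensity M (gInit μ0 S0) (gTrans mfun cov) L (aIdx i) (bIdx i) z =
      ∑ j, c' j * trajDensity M (gInit μ0 S0) (gTrans mfun cov) L (aIdx' j) (bIdx' j) z) :
    K0 * K ^ L = K0' * K' ^ L ∧ K0 = K0' ∧ K = K' ∧
      ∀ i, ∃ j, c i = c' j ∧
        (∀ s1 s2 : Fin L, bIdx i s1 = bIdx i s2 ↔ bIdx' j s1 = bIdx' j s2) ∧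
        (∀ h, gInit μ0 S0 (aIdx i) h = gInit μ0 S0 (aIdx' j) h) ∧
        (∀ (s : Fin L) (x : Fin m → ℝ) (h : Fin M → Fin m → ℝ),
          gTrans mfun cov (bIdx i s) x h = gTrans mfun cov (bIdx' j s) x h) := by
  classical
  have hmain : ∀ p : A × (Fin L → B),
      (∑ i with (aIdx i, bIdx i) = p, c i) = ∑ j with (aIdx' j, bIdx' j) = p, c' j := by
    intro p
    set s : Finset (A × (Fin L → B)) := insert p (Finset.univ.image (fun i => (aIdx i, bIdx i)) ∪
      Finset.univ.image (fun j => (aIdx' j, bIdx' j))) with hs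
    have := aux_main hM μ0 S0 mfun cov hS0pd hcovpd huniq_init huniq_trans hmean_an hcov_an L s
      Prod.fst Prod.snd
      (fun p => (∑ i with (aIdx i, bIdx i) = p, c i) - ∑ j with (aIdx' j, bIdx' j) = p, c' j)
      (fun i _ j _ h1 h2 => Prod.ext h1 h2) ?_ p (by simp [hs])
    · exact sub_eq_zero.1 this
    · intro z
      simp only [sub_mul, Finset.sum_sub_distrib]
      rw [sub_eq_zero]
      have e1 := Finset.sum_fiberwise_of_maps_to (s := Finset.univ) (t := s)
        (g := fun i => (aIdx i, bIdx i)) (fun i _ => Finset.mem_insert_of_mem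
          (Finset.mem_union_left _ (Finset.mem_image_of_mem _ (Finset.mem_univ i))))
        (fun i => c i * trajDensity M (gInit μ0 S0) (gTrans mfun cov) L (aIdx i) (bIdx i) z)
      have e2 := Finset.sum_fiberwise_of_maps_to (s := Finset.univ) (t := s)
        (g := fun j => (aIdx' j, bIdx' j)) (fun i _ => Finset.mem_insert_of_mem
          (Finset.mem_union_right _ (Finset.mem_image_of_mem _ (Finset.mem_univ i))))
        (fun j => c' j * trajDensity M (gInit μ0 S0) (gTrans mfun cov) L (aIdx' j) (bIdx' j) z)
      have e3 := e1.trans ((heq z).trans e2.symm)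
      convert e3 using 1
      · refine Finset.sum_congr rfl (fun p _ => ?_)
        rw [Finset.sum_mul]
        refine Finset.sum_congr rfl (fun i hi => ?_)
        rw [← (Finset.mem_filter.1 hi).2]
      · refine Finset.sum_congr rfl (fun p _ => ?_)
        rw [Finset.sum_mul]
        refine Finset.sum_congr rfl (fun i hi => ?_)
        rw [← (Finset.mem_filter.1 hi).2]
  have hs1 : ∀ i, (∑ i' with (aIdx i', bIdx i') = (aIdx i, bIdx i), c i') = c i := by
    intro i
    have : (Finset.univ.filter fun i' => (aIdx i', bIdx i') = (aIdx i, bIdx i)) = {i} := by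
      ext k; simp only [Finset.mem_filter, Finset.mem_univ, true_and, Finset.mem_singleton]
      exact hdistinct.eq_iff (a := k) (b := i)
    rw [this, Finset.sum_singleton]
  have hs2 : ∀ j, (∑ j' with (aIdx' j', bIdx' j') = (aIdx' j, bIdx' j), c' j') = c' j := by
    intro i
    have : (Finset.univ.filter fun i' => (aIdx' i', bIdx' i') = (aIdx' i, bIdx' i)) = {i} := by
      ext k; simp only [Finset.mem_filter, Finset.mem_univ, true_and, Finset.mem_singleton]
      exact hdistinct'.eq_iff (a := k) (b := i)
    rw [this, Finset.sum_singleton]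
  have hA : ∀ i, ∃ j, (aIdx' j, bIdx' j) = (aIdx i, bIdx i) ∧ c i = c' j := by
    intro i
    have h1 := hmain (aIdx i, bIdx i)
    rw [hs1] at h1
    obtain ⟨j, hj, -⟩ := Finset.exists_ne_zero_of_sum_ne_zero (h1 ▸ (hc i).ne')
    have hj := (Finset.mem_filter.1 hj).2
    refine ⟨j, hj, ?_⟩
    rw [h1, ← hj, hs2]
  have hB : ∀ j, ∃ i, (aIdx i, bIdx i) = (aIdx' j, bIdx' j) := by
    intro j
    have h1 := hmain (aIdx' j, bIdx' j)
    rw [hs2] at h1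
    obtain ⟨i, hi, -⟩ := Finset.exists_ne_zero_of_sum_ne_zero (h1 ▸ (hc' j).ne')
    exact ⟨i, (Finset.mem_filter.1 hi).2⟩
  obtain ⟨A0, hA0c, hA0⟩ := hA0
  obtain ⟨A0', hA0c', hA0'⟩ := hA0'
  obtain ⟨B0, hB0c, hB0⟩ := hB0
  obtain ⟨B0', hB0c', hB0'⟩ := hB0'
  have him : Finset.univ.image (fun i => (aIdx i, bIdx i)) =
      A0 ×ˢ Fintype.piFinset (fun _ : Fin L => B0) := by
    refine Finset.eq_of_subset_of_card_le ?_ ?_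
    · intro p hp
      obtain ⟨i, -, rfl⟩ := Finset.mem_image.1 hp
      simp [hA0, hB0]
    · rw [Finset.card_image_of_injective _ hdistinct]
      simp [hA0c, hB0c]
  have him' : Finset.univ.image (fun i => (aIdx' i, bIdx' i)) =
      A0' ×ˢ Fintype.piFinset (fun _ : Fin L => B0') := by
    refine Finset.eq_of_subset_of_card_le ?_ ?_
    · intro p hp
      obtain ⟨i, -, rfl⟩ := Finset.mem_image.1 hp
      simp [hA0', hB0']
    · rw [Finset.card_image_of_injective _ hdistinct']
      simp [hA0c', hB0c']
  have hee : A0 ×ˢ Fintype.piFinset (fun _ : Fin L => B0) =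
      A0' ×ˢ Fintype.piFinset (fun _ : Fin L => B0') := by
    rw [← him, ← him']
    ext p
    simp only [Finset.mem_image, Finset.mem_univ, true_and]
    constructor
    · rintro ⟨i, rfl⟩
      obtain ⟨j, hj, -⟩ := hA i
      exact ⟨j, hj⟩
    · rintro ⟨j, rfl⟩
      exact hB j
  have hmem : ∀ x (y : Fin L → B), (x ∈ A0 ∧ ∀ s, y s ∈ B0) ↔ (x ∈ A0' ∧ ∀ s, y s ∈ B0') := by
    intro x y
    have := congrArg (fun S => (x, y) ∈ S) hee
    simpa using this
  have hne : Nonempty (Fin (K0 * K ^ L)) := by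
    by_contra hcon
    rw [not_nonempty_iff] at hcon
    simp at hcsum
  obtain ⟨i0⟩ := hne
  have h0 := (hmem (aIdx i0) (bIdx i0)).1 ⟨hA0 _, hB0 _⟩
  have hAA : A0 = A0' := by
    ext x
    have := hmem x (bIdx i0)
    have h1 := hB0 i0
    have h2 := h0.2
    tauto
  have hBB : B0 = B0' := by
    ext y
    have := hmem (aIdx i0) (fun _ => y)
    have h1 := hA0 i0
    have h2 := h0.1
    have : Nonempty (Fin L) := ⟨⟨0, hL⟩⟩
    simp_all
  have hK0 : K0 = K0' := by rw [← hA0c, ← hA0c', hAA]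
  have hK : K = K' := by rw [← hB0c, ← hB0c', hBB]
  refine ⟨by rw [hK0, hK], hK0, hK, ?_⟩
  intro i
  obtain ⟨j, hj, hcj⟩ := hA i
  rw [Prod.mk.injEq] at hj
  refine ⟨j, hcj, ?_, ?_, ?_⟩
  · intro s1 s2; rw [hj.2]
  · intro h; rw [hj.1]
  · intro s x h; rw [hj.2]
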